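/- The secure computation problem (p_XY, p_{Z|XY}) is computable with asymptotic security if and only if it is computable with perfect security. -/

import Mathlib

open scoped BigOperators
open scoped Classical

namespace SC

/-- `p` is a probability mass function on a finite type. -/
def IsPMF {α : Type*} [Fintype α] (p : α → ℝ) : Prop :=
  (∀ a, 0 ≤ p a) ∧ ∑ a, p a = 1

/-- Total variation distance between pmfs on a finite type. -/
noncomputable def tv {α : Type*} [Fintype α] (p q : α → ℝ) : ℝ :=
  (1 / 2) * ∑ a, |p a - q a|

/-- Shannon entropy (in bits) of the pushforward of the pmf `p` along `f`. -/
noncomputable def Hof {Ω β : Type*} [Fintype Ω] (p : Ω → ℝ) (f : Ω → β) : ℝ :=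
  (∑ b ∈ Finset.univ.image f,
      Real.negMulLog (∑ a ∈ Finset.univ.filter (fun a => f a = b), p a)) / Real.log 2

/-- Conditional Shannon entropy `H(A | B)` (bits) computed from the joint pmf `p`. -/
noncomputable def condEnt {Ω α β : Type*} [Fintype Ω] (p : Ω → ℝ)
    (A : Ω → α) (B : Ω → β) : ℝ :=
  Hof p (fun ω => (A ω, B ω)) - Hof p B

/-- Conditional mutual information `I(A ; C ∣ B)` (bits) from the joint pmf `p`. -/
noncomputable def cmi {Ω α β γ : Type*} [Fintype Ω] (p : Ω → ℝ)
    (A : Ω → α) (B : Ω → β) (C : Ω → γ) : ℝ :=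
  Hof p (fun ω => (A ω, B ω)) + Hof p (fun ω => (B ω, C ω)) - Hof p B
    - Hof p (fun ω => (A ω, B ω, C ω))

/-- The joint pmf `p_XYZ(x,y,z) = p_XY(x,y) · p_{Z|XY}(z|x,y)`. -/
noncomputable def jointXYZ {𝒳 𝒴 𝒵 : Type*} [Fintype 𝒳] [Fintype 𝒴] [Fintype 𝒵]
    (pXY : 𝒳 × 𝒴 → ℝ) (Q : 𝒳 → 𝒴 → 𝒵 → ℝ) : 𝒳 × 𝒴 × 𝒵 → ℝ :=
  fun w => pXY (w.1, w.2.1) * Q w.1 w.2.1 w.2.2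

/-- The `n`-fold product of `p_XYZ`. -/
noncomputable def prodXYZ {𝒳 𝒴 𝒵 : Type*} [Fintype 𝒳] [Fintype 𝒴] [Fintype 𝒵]
    (pXY : 𝒳 × 𝒴 → ℝ) (Q : 𝒳 → 𝒴 → 𝒵 → ℝ) (n : ℕ) :
    (Fin n → 𝒳) × (Fin n → 𝒴) × (Fin n → 𝒵) → ℝ :=
  fun w => ∏ i, jointXYZ pXY Q (w.1 i, w.2.1 i, w.2.2 i)

/-- The joint pmf of `(U, X, Y, Z)` obtained from `p_XYZ` and a conditional pmf
`p_{U|XYZ}` (with `U` ranging over `Fin k`). -/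
noncomputable def jointU {𝒳 𝒴 𝒵 : Type*} [Fintype 𝒳] [Fintype 𝒴] [Fintype 𝒵]
    (pXY : 𝒳 × 𝒴 → ℝ) (Q : 𝒳 → 𝒴 → 𝒵 → ℝ) {k : ℕ}
    (pU : 𝒳 × 𝒴 × 𝒵 → Fin k → ℝ) : Fin k × 𝒳 × 𝒴 × 𝒵 → ℝ :=
  fun w => jointXYZ pXY Q w.2 * pU w.2 w.1

/-- Message set cardinality `⌈2^{nR}⌉`. -/
noncomputable def msgCard (n : ℕ) (R : ℝ) : ℕ := ⌈(2 : ℝ) ^ ((n : ℝ) * R)⌉₊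

/-- Joint pmf on `(Xⁿ, Yⁿ, M, Ẑⁿ)` induced by an `(n, 2^{nR})`-code `(enc, dec)`. -/
noncomputable def inducedPMF {𝒳 𝒴 𝒵 : Type*} [Fintype 𝒳] [Fintype 𝒴] [Fintype 𝒵]
    (pXY : 𝒳 × 𝒴 → ℝ) (n : ℕ) (R : ℝ)
    (enc : (Fin n → 𝒳) → Fin (msgCard n R) → ℝ)
    (dec : Fin (msgCard n R) → (Fin n → 𝒴) → (Fin n → 𝒵) → ℝ) :
    (Fin n → 𝒳) × (Fin n → 𝒴) × Fin (msgCard n R) × (Fin n → 𝒵) → ℝ :=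
  fun w => (∏ i, pXY (w.1 i, w.2.1 i)) * enc w.1 w.2.2.1 * dec w.2.2.1 w.2.1 w.2.2.2

/-- A rate `R ≥ 0` is securely achievable for `(p_XY, p_{Z|XY})`: there is a sequence of
`(n, 2^{nR})`-codes such that for every `ε > 0` there is an `n` with
`‖p_{XⁿYⁿẐⁿ} − p_{XⁿYⁿZⁿ}‖₁ ≤ ε` and `I(M; Xⁿ | Yⁿ, Ẑⁿ) ≤ nε`. -/
def SecurelyAchievable {𝒳 𝒴 𝒵 : Type*} [Fintype 𝒳] [Fintype 𝒴] [Fintype 𝒵]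
    (pXY : 𝒳 × 𝒴 → ℝ) (Q : 𝒳 → 𝒴 → 𝒵 → ℝ) (R : ℝ) : Prop :=
  0 ≤ R ∧
  ∃ enc : (n : ℕ) → (Fin n → 𝒳) → Fin (msgCard n R) → ℝ,
  ∃ dec : (n : ℕ) → Fin (msgCard n R) → (Fin n → 𝒴) → (Fin n → 𝒵) → ℝ,
    (∀ n xs, IsPMF (enc n xs)) ∧ (∀ n m ys, IsPMF (dec n m ys)) ∧
    ∀ ε : ℝ, 0 < ε → ∃ n : ℕ, 0 < n ∧
      tv (fun w : (Fin n → 𝒳) × (Fin n → 𝒴) × (Fin n → 𝒵) =>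
            ∑ m, inducedPMF pXY n R (enc n) (dec n) (w.1, w.2.1, m, w.2.2))
         (prodXYZ pXY Q n) ≤ ε ∧
      cmi (inducedPMF pXY n R (enc n) (dec n))
        (fun w => w.2.2.1) (fun w => (w.2.1, w.2.2.2)) (fun w => w.1) ≤ n * ε

/-- `p_{U|XYZ}` is a conditional pmf whose joint pmf `p_XYZ · p_{U|XYZ}` satisfies the
three Markov chains `U−X−Y`, `Z−(U,Y)−X` and `U−(Y,Z)−X`. -/
def SecureAux {𝒳 𝒴 𝒵 : Type*} [Fintype 𝒳] [Fintype 𝒴] [Fintype 𝒵]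
    (pXY : 𝒳 × 𝒴 → ℝ) (Q : 𝒳 → 𝒴 → 𝒵 → ℝ) {k : ℕ}
    (pU : 𝒳 × 𝒴 × 𝒵 → Fin k → ℝ) : Prop :=
  (∀ w, IsPMF (pU w)) ∧
  cmi (jointU pXY Q pU) (fun w => w.1) (fun w => w.2.1) (fun w => w.2.2.1) = 0 ∧
  cmi (jointU pXY Q pU) (fun w => w.2.2.2) (fun w => (w.1, w.2.2.1)) (fun w => w.2.1) = 0 ∧
  cmi (jointU pXY Q pU) (fun w => w.1) (fun w => (w.2.2.1, w.2.2.2)) (fun w => w.2.1) = 0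

/-- `(p_XY, p_{Z|XY})` is computable with perfect security. -/
def PerfectlySecure {𝒳 𝒴 𝒵 : Type*} [Fintype 𝒳] [Fintype 𝒴] [Fintype 𝒵]
    (pXY : 𝒳 × 𝒴 → ℝ) (Q : 𝒳 → 𝒴 → 𝒵 → ℝ) : Prop :=
  ∃ (k : ℕ) (pU : 𝒳 × 𝒴 × 𝒵 → Fin k → ℝ), SecureAux pXY Q pU

section Entropy

variable {Ω α β γ : Type*} [Fintype Ω]

/-- The pushforward of the weight function `p` along `f`. -/
noncomputable def marg (p : Ω → ℝ) (f : Ω → β) (b : β) : ℝ :=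
  ∑ a, if f a = b then p a else 0

/-- Shannon entropy, in nats, of the pushforward of `p` along `f`. -/
noncomputable def ent (p : Ω → ℝ) (f : Ω → β) : ℝ :=
  -∑ a, p a * Real.log (marg p f (f a))

lemma sum_marg_mul [Fintype β] (p : Ω → ℝ) (f : Ω → β) (g : β → ℝ) :
    ∑ b, marg p f b * g b = ∑ a, p a * g (f a) := by
  simp only [marg, Finset.sum_mul]
  rw [Finset.sum_comm]
  simp [ite_mul]

lemma sum_marg [Fintype β] (p : Ω → ℝ) (f : Ω → β) : ∑ b, marg p f b = ∑ a, p a := by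
  simpa using sum_marg_mul p f 1

lemma marg_marg [Fintype β] (p : Ω → ℝ) (f : Ω → β) (g : β → γ) :
    marg (marg p f) g = marg p (fun a => g (f a)) := by
  funext c
  have := sum_marg_mul p f (fun b => if g b = c then 1 else 0)
  simpa [marg] using this

lemma marg_nonneg {p : Ω → ℝ} (hp : ∀ a, 0 ≤ p a) (f : Ω → β) (b : β) : 0 ≤ marg p f b :=
  Finset.sum_nonneg fun a _ => by split_ifs <;> simp [hp a]

lemma le_marg {p : Ω → ℝ} (hp : ∀ a, 0 ≤ p a) (f : Ω → β) (a : Ω) : p a ≤ marg p f (f a) := by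
  have := Finset.single_le_sum (f := fun a' => if f a' = f a then p a' else 0)
    (fun a' _ => by split_ifs <;> simp [hp a']) (Finset.mem_univ a)
  simpa [marg] using this

lemma IsPMF.marg [Fintype β] {p : Ω → ℝ} (hp : IsPMF p) (f : Ω → β) : IsPMF (marg p f) :=
  ⟨marg_nonneg hp.1 f, by rw [sum_marg, hp.2]⟩

lemma IsPMF.le_one {p : Ω → ℝ} (hp : IsPMF p) (a : Ω) : p a ≤ 1 :=
  hp.2 ▸ Finset.single_le_sum (fun a _ => hp.1 a) (Finset.mem_univ a)

lemma marg_apply_of_injective (p : Ω → ℝ) {f : Ω → β} (hf : Function.Injective f) (a : Ω) :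
    marg p f (f a) = p a := by
  simp [marg, hf.eq_iff]

lemma ent_eq_sum [Fintype β] (p : Ω → ℝ) (f : Ω → β) :
    ent p f = ∑ b, Real.negMulLog (marg p f b) := by
  have := sum_marg_mul p f (fun b => Real.log (marg p f b))
  simp [ent, ← this, Real.negMulLog]

lemma Hof_eq (p : Ω → ℝ) (f : Ω → β) : Hof p f = ent p f / Real.log 2 := by
  unfold Hof ent
  congr 1
  simp only [Real.negMulLog, ← Finset.sum_filter, marg, neg_mul, Finset.sum_neg_distrib]
  rw [← Finset.sum_fiberwise_of_maps_to (s := Finset.univ) (t := Finset.univ.image f) (g := f)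
    (fun a _ => Finset.mem_image_of_mem f (Finset.mem_univ a))]
  congr 1
  refine Finset.sum_congr rfl fun b _ => ?_
  rw [Finset.sum_mul]
  refine Finset.sum_congr rfl fun a ha => ?_
  rw [(Finset.mem_filter.mp ha).2]

lemma ent_congr (p : Ω → ℝ) {f : Ω → β} {g : Ω → γ} (h : ∀ a a', f a = f a' ↔ g a = g a') :
    ent p f = ent p g := by
  simp only [ent, marg, h]

lemma ent_marg [Fintype β] (p : Ω → ℝ) (f : Ω → β) (g : β → γ) :
    ent (marg p f) g = ent p (fun a => g (f a)) := by
  simp only [ent, marg_marg]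
  rw [sum_marg_mul p f (fun b => Real.log (marg p (fun a => g (f a)) (g b)))]

/-- Conditional mutual information in nats. -/
noncomputable def cmiNat (p : Ω → ℝ) (A : Ω → α) (B : Ω → β) (C : Ω → γ) : ℝ :=
  ent p (fun ω => (A ω, B ω)) + ent p (fun ω => (B ω, C ω)) - ent p B
    - ent p (fun ω => (A ω, B ω, C ω))

lemma cmi_eq (p : Ω → ℝ) (A : Ω → α) (B : Ω → β) (C : Ω → γ) :
    cmi p A B C = cmiNat p A B C / Real.log 2 := by
  simp only [cmi, cmiNat, Hof_eq]; ring

lemma cmi_eq_zero_iff (p : Ω → ℝ) (A : Ω → α) (B : Ω → β) (C : Ω → γ) :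
    cmi p A B C = 0 ↔ cmiNat p A B C = 0 := by
  have : Real.log 2 ≠ 0 := (Real.log_pos one_lt_two).ne'
  simp [cmi_eq, this]

/-- The pointwise defect of Gibbs' inequality. -/
lemma gibbs_term {p q : ℝ} (hp : 0 ≤ p) (hq : 0 ≤ q) (hpq : q = 0 → p = 0) :
    0 ≤ p * Real.log p - p * Real.log q - p + q ∧
      (p * Real.log p - p * Real.log q - p + q = 0 → p = q) := by
  rcases hq.eq_or_lt with h | h
  · simp [← h, hpq h.symm]
  rcases hp.eq_or_lt with h' | h'
  · simp only [← h']; simp; exact ⟨h.le, fun h => h.symm⟩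
  have e : p * Real.log p - p * Real.log q - p + q = q * InformationTheory.klFun (p / q) := by
    rw [InformationTheory.klFun_apply, Real.log_div h'.ne' h.ne']
    field_simp; ring
  have hd : 0 ≤ p / q := by positivity
  rw [e]
  refine ⟨mul_nonneg hq (InformationTheory.klFun_nonneg hd), fun h0 => ?_⟩
  have := (mul_eq_zero.mp h0).resolve_left h.ne'
  rw [InformationTheory.klFun_eq_zero_iff hd] at this
  rwa [div_eq_one_iff_eq h.ne'] at this

lemma marg_fst_eq [Fintype α] (p : Ω → ℝ) (A : Ω → α) (B : Ω → β) (b : β) :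
    ∑ a, marg p (fun ω => (A ω, B ω)) (a, b) = marg p B b := by
  simp only [marg]
  rw [Finset.sum_comm]
  refine Finset.sum_congr rfl fun ω _ => ?_
  simp [Prod.ext_iff, ite_and]

lemma marg_snd_eq [Fintype β] (p : Ω → ℝ) (A : Ω → α) (B : Ω → β) (a : α) :
    ∑ b, marg p (fun ω => (A ω, B ω)) (a, b) = marg p A a := by
  simp only [marg]
  rw [Finset.sum_comm]
  refine Finset.sum_congr rfl fun ω _ => ?_
  simp only [Prod.ext_iff, and_comm (a := A ω = a)]
  simp [ite_and]

variable [Fintype α] [Fintype β] [Fintype γ]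

/-- Conditional mutual information as a relative entropy. -/
lemma cmiNat_nonneg_and_eq_zero_iff {p : Ω → ℝ} (hp : IsPMF p)
    (A : Ω → α) (B : Ω → β) (C : Ω → γ) :
    0 ≤ cmiNat p A B C ∧ (cmiNat p A B C = 0 ↔ ∀ a b c,
      marg p (fun ω => (A ω, B ω, C ω)) (a, b, c) * marg p B b =
        marg p (fun ω => (A ω, B ω)) (a, b) * marg p (fun ω => (B ω, C ω)) (b, c)) := by
  set P := marg p (fun ω => (A ω, B ω, C ω)) with hP
  set PA := marg p (fun ω => (A ω, B ω)) with hPA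
  set PC := marg p (fun ω => (B ω, C ω)) with hPC
  set PB := marg p B with hPB
  let q : α × β × γ → ℝ := fun w => PA (w.1, w.2.1) * PC w.2 / PB w.2.1
  have hP0 : ∀ w, 0 ≤ P w := marg_nonneg hp.1 _
  have hPA0 : ∀ w, 0 ≤ PA w := marg_nonneg hp.1 _
  have hPC0 : ∀ w, 0 ≤ PC w := marg_nonneg hp.1 _
  have hPB0 : ∀ w, 0 ≤ PB w := marg_nonneg hp.1 _
  have mA : marg P (fun w => (w.1, w.2.1)) = PA := marg_marg ..
  have mC : marg P (fun w => w.2) = PC := marg_marg ..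
  have mB : marg P (fun w => w.2.1) = PB := marg_marg ..
  have lA : ∀ w, P w ≤ PA (w.1, w.2.1) := fun w => mA ▸ le_marg hP0 (fun w => (w.1, w.2.1)) w
  have lC : ∀ w, P w ≤ PC w.2 := fun w => mC ▸ le_marg hP0 (fun w => w.2) w
  have lB : ∀ w, P w ≤ PB w.2.1 := fun w => mB ▸ le_marg hP0 (fun w => w.2.1) w
  have sA : ∀ b, ∑ a, PA (a, b) = PB b := marg_fst_eq p A B
  have sC : ∀ b, ∑ c, PC (b, c) = PB b := marg_snd_eq p B C
  have lCB : ∀ w, PC w ≤ PB w.1 := fun w => by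
    rw [← sC]; exact Finset.single_le_sum (f := fun c => PC (w.1, c)) (fun _ _ => hPC0 _)
      (Finset.mem_univ w.2)
  have hq0 : ∀ w, 0 ≤ q w := fun w => div_nonneg (mul_nonneg (hPA0 _) (hPC0 _)) (hPB0 _)
  have key : ∀ w, 0 < P w → 0 < PA (w.1, w.2.1) ∧ 0 < PC w.2 ∧ 0 < PB w.2.1 := fun w h =>
    ⟨h.trans_le (lA w), h.trans_le (lC w), h.trans_le (lB w)⟩
  have hpq : ∀ w, q w = 0 → P w = 0 := fun w h => by
    by_contra hne
    obtain ⟨h1, h2, h3⟩ := key w ((hP0 w).lt_of_ne' hne)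
    have : 0 < q w := by positivity
    exact this.ne' h
  have sumq : ∑ w, q w = 1 := by
    have hBs : ∑ b, PB b = 1 := (hp.marg B).2
    rw [Fintype.sum_prod_type_right, Fintype.sum_prod_type, ← hBs]
    refine Finset.sum_congr rfl fun b _ => ?_
    have : ∀ c, ∑ a, q (a, b, c) = PB b * PC (b, c) / PB b := fun c => by
      simp only [q, ← sA b, Finset.sum_mul, Finset.sum_div]
    simp only [this, ← Finset.sum_div, ← Finset.mul_sum, sC]
    rcases eq_or_ne (PB b) 0 with h | h
    · simp [h]
    · field_simp
  have sumP : ∑ w, P w = 1 := (hp.marg _).2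
  have hI : cmiNat p A B C = ∑ w, (P w * Real.log (P w) - P w * Real.log (q w) - P w + q w) := by
    have e1 : cmiNat p A B C = ∑ w, P w * (Real.log (P w) + Real.log (PB w.2.1)
        - Real.log (PA (w.1, w.2.1)) - Real.log (PC w.2)) := by
      rw [hP, sum_marg_mul p (fun ω => (A ω, B ω, C ω)) (fun w => (Real.log (P w) +
        Real.log (PB w.2.1) - Real.log (PA (w.1, w.2.1)) - Real.log (PC w.2)))]
      simp only [cmiNat, ent, mul_sub, mul_add, Finset.sum_sub_distrib, Finset.sum_add_distrib]
      ring
    rw [Finset.sum_add_distrib, Finset.sum_sub_distrib, sumq, sumP, sub_add_cancel, e1]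
    refine Finset.sum_congr rfl fun w _ => ?_
    rcases (hP0 w).eq_or_lt with h | h
    · simp [← h]
    obtain ⟨h1, h2, h3⟩ := key w h
    simp only [q]
    rw [Real.log_div (mul_pos h1 h2).ne' h3.ne', Real.log_mul h1.ne' h2.ne']
    ring
  have hterm := fun w => gibbs_term (hP0 w) (hq0 w) (hpq w)
  refine ⟨hI ▸ Finset.sum_nonneg fun w _ => (hterm w).1, ?_⟩
  rw [hI, Finset.sum_eq_zero_iff_of_nonneg fun w _ => (hterm w).1]
  constructor
  · intro h a b c
    have := (hterm (a, b, c)).2 (h _ (Finset.mem_univ _))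
    rw [this]
    simp only [q]
    rcases eq_or_ne (PB b) 0 with h' | h'
    · have : PC (b, c) = 0 := le_antisymm (h' ▸ lCB (b, c)) (hPC0 _)
      simp [h', this]
    · field_simp
  · rintro h ⟨a, b, c⟩ -
    have : P (a, b, c) = q (a, b, c) := by
      simp only [q, ← h]
      rcases eq_or_ne (PB b) 0 with h' | h'
      · have : P (a, b, c) = 0 := le_antisymm (h' ▸ lB (a, b, c)) (hP0 _)
        simp [this]
      · field_simp
    rw [this]; ring

lemma cmiNat_nonneg {p : Ω → ℝ} (hp : IsPMF p) (A : Ω → α) (B : Ω → β) (C : Ω → γ) :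
    0 ≤ cmiNat p A B C := (cmiNat_nonneg_and_eq_zero_iff hp A B C).1

lemma cmiNat_eq_zero_iff {p : Ω → ℝ} (hp : IsPMF p) (A : Ω → α) (B : Ω → β) (C : Ω → γ) :
    cmiNat p A B C = 0 ↔ ∀ a b c,
      marg p (fun ω => (A ω, B ω, C ω)) (a, b, c) * marg p B b =
        marg p (fun ω => (A ω, B ω)) (a, b) * marg p (fun ω => (B ω, C ω)) (b, c) :=
  (cmiNat_nonneg_and_eq_zero_iff hp A B C).2

/-- A joint pmf of the form `f(a,b) g(b,c)` makes `A - B - C` a Markov chain. -/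
lemma cmiNat_eq_zero_of_factor {p : Ω → ℝ} (hp : IsPMF p) (A : Ω → α) (B : Ω → β) (C : Ω → γ)
    (f : α → β → ℝ) (g : β → γ → ℝ)
    (h : ∀ a b c, marg p (fun ω => (A ω, B ω, C ω)) (a, b, c) = f a b * g b c) :
    cmiNat p A B C = 0 := by
  rw [cmiNat_eq_zero_iff hp]
  intro a b c
  have h1 : ∀ a b, marg p (fun ω => (A ω, B ω)) (a, b) = f a b * ∑ c, g b c := fun a b => by
    have := marg_snd_eq p (fun ω => (A ω, B ω)) C (a, b)
    rw [← this, Finset.mul_sum]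
    refine Finset.sum_congr rfl fun c _ => ?_
    rw [← h]
    simp only [marg, Prod.mk.injEq, and_assoc]
  have h2 : ∀ b c, marg p (fun ω => (B ω, C ω)) (b, c) = (∑ a, f a b) * g b c := fun b c => by
    rw [← marg_fst_eq p A (fun ω => (B ω, C ω)), Finset.sum_mul]
    simp only [h]
  have h3 : marg p B b = (∑ a, f a b) * ∑ c, g b c := by
    rw [← marg_fst_eq p A B, Finset.sum_mul]
    simp only [h1]
  rw [h, h1, h2, h3]; ring

end Entropy

section Continuity

open Real

/-- Modulus of continuity of entropy with respect to the `ℓ¹` distance `t`. -/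
noncomputable def entModulus (c t : ℝ) : ℝ := t * c + negMulLog t + t

lemma negMulLog_add_le {s t : ℝ} (hs : 0 ≤ s) (ht : 0 ≤ t) :
    negMulLog (s + t) ≤ negMulLog s + negMulLog t := by
  rcases hs.eq_or_lt with h | h
  · simp [← h]
  rcases ht.eq_or_lt with h' | h'
  · simp [← h']
  have h1 : log s ≤ log (s + t) := log_le_log h (by linarith)
  have h2 : log t ≤ log (s + t) := log_le_log h' (by linarith)
  simp only [negMulLog]
  nlinarith

lemma negMulLog_sub_le {s t : ℝ} (hs : 0 ≤ s) (ht : 0 ≤ t) (hst : s + t ≤ 1) :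
    negMulLog s - negMulLog (s + t) ≤ t := by
  rcases hs.eq_or_lt with h | h
  · have := negMulLog_nonneg (x := t) ht (by linarith)
    simp [← h]; linarith
  have hl : log (s + t) ≤ 0 := log_nonpos (by linarith) hst
  have h1 : log (s + t) - log s ≤ t / s := by
    rw [← log_div (by linarith) h.ne']
    refine (log_le_sub_one_of_pos (by positivity)).trans (le_of_eq ?_)
    field_simp; ring
  have h2 : s * (log (s + t) - log s) ≤ t := by
    calc _ ≤ s * (t / s) := by gcongr
      _ = t := by field_simp
  simp only [negMulLog]
  nlinarith

lemma abs_negMulLog_sub_le {s t : ℝ} (hs : 0 ≤ s) (ht : 0 ≤ t) (hs1 : s ≤ 1) (ht1 : t ≤ 1) :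
    |negMulLog s - negMulLog t| ≤ negMulLog |s - t| + |s - t| := by
  wlog h : s ≤ t generalizing s t
  · rw [abs_sub_comm, abs_sub_comm s t]
    exact this ht hs ht1 hs1 (le_of_not_ge h)
  obtain ⟨d, rfl⟩ := exists_add_of_le h
  have hd : 0 ≤ d := by linarith
  have e : |s - (s + d)| = d := by rw [sub_add_cancel_left, abs_neg, abs_of_nonneg hd]
  have h1 := negMulLog_add_le hs hd
  have h2 := negMulLog_sub_le hs hd ht1
  have h3 := negMulLog_nonneg hd (by linarith)
  rw [e, abs_le]
  constructor <;> linarith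

lemma sum_negMulLog_le {ι : Type*} [Fintype ι] [Nonempty ι] {t : ι → ℝ} (ht : ∀ i, 0 ≤ t i) :
    ∑ i, negMulLog (t i) ≤ negMulLog (∑ i, t i) + (∑ i, t i) * log (Fintype.card ι) := by
  have hN : (0 : ℝ) < Fintype.card ι := by exact_mod_cast Fintype.card_pos
  have := concaveOn_negMulLog.le_map_sum (t := Finset.univ)
    (w := fun _ : ι => (Fintype.card ι : ℝ)⁻¹) (p := t) (fun _ _ => by positivity)
    (by simp [hN.ne']) (fun i _ => ht i)
  simp only [smul_eq_mul, ← Finset.mul_sum] at this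
  rw [negMulLog_mul, negMulLog, log_inv] at this
  have h2 := mul_le_mul_of_nonneg_left this hN.le
  field_simp at h2
  linarith

/-- Continuity of entropy in the total variation distance (Fannes' inequality). -/
lemma abs_ent_sub_le {Ω β : Type*} [Fintype Ω] [Fintype β] [Nonempty β] {p q : Ω → ℝ}
    (hp : IsPMF p) (hq : IsPMF q) (f : Ω → β) {L : ℝ}
    (hcard : log (Fintype.card β) ≤ L) :
    ∃ t, 0 ≤ t ∧ t ≤ ∑ a, |p a - q a| ∧ |ent p f - ent q f| ≤ entModulus L t := by
  have hp' := hp.marg f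
  have hq' := hq.marg f
  refine ⟨∑ b, |marg p f b - marg q f b|, by positivity, ?_, ?_⟩
  · calc ∑ b, |marg p f b - marg q f b|
        ≤ ∑ b, marg (fun a => |p a - q a|) f b := by
          refine Finset.sum_le_sum fun b _ => ?_
          simp only [marg, ← Finset.sum_sub_distrib]
          refine (Finset.abs_sum_le_sum_abs _ _).trans (Finset.sum_le_sum fun a _ => ?_)
          split_ifs <;> simp
      _ = _ := sum_marg _ f
  · rw [ent_eq_sum, ent_eq_sum, ← Finset.sum_sub_distrib]
    calc |∑ b, (negMulLog (marg p f b) - negMulLog (marg q f b))|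
        ≤ ∑ b, |negMulLog (marg p f b) - negMulLog (marg q f b)| :=
          Finset.abs_sum_le_sum_abs _ _
      _ ≤ ∑ b, (negMulLog |marg p f b - marg q f b| + |marg p f b - marg q f b|) :=
          Finset.sum_le_sum fun b _ =>
            abs_negMulLog_sub_le (hp'.1 b) (hq'.1 b) (hp'.le_one b) (hq'.le_one b)
      _ ≤ _ := by
          rw [Finset.sum_add_distrib, entModulus]
          have := sum_negMulLog_le (t := fun b => |marg p f b - marg q f b|) (fun _ => abs_nonneg _)
          have h0 : (0 : ℝ) ≤ ∑ b, |marg p f b - marg q f b| := by positivity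
          have := mul_le_mul_of_nonneg_left hcard h0
          linarith

lemma exists_entModulus_le (c : ℝ) {δ : ℝ} (hδ : 0 < δ) :
    ∃ θ, 0 < θ ∧ ∀ t, 0 ≤ t → t ≤ θ → entModulus c t ≤ δ := by
  have hcont : Continuous (entModulus c) := by
    unfold entModulus; fun_prop
  obtain ⟨θ, hθ, h⟩ := Metric.continuous_iff.mp hcont 0 δ hδ
  refine ⟨θ / 2, by positivity, fun t h0 h1 => ?_⟩
  have := h t (by rw [Real.dist_eq, sub_zero, abs_of_nonneg h0]; linarith)
  rw [Real.dist_eq] at this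
  have h2 := le_of_lt (lt_of_abs_lt this)
  simpa [entModulus] using h2

end Continuity

section Sequences

open Real

variable {Ω α β γ : Type*} [Fintype Ω] [Fintype α] [Fintype β] [Fintype γ]

/-- Conditional entropy in nats. -/
noncomputable def centNat {Ω α β : Type*} [Fintype Ω] (p : Ω → ℝ) (A : Ω → α) (B : Ω → β) : ℝ :=
  ent p (fun ω => (A ω, B ω)) - ent p B

/-- Conditioning on more data decreases entropy. -/
lemma centNat_le {p : Ω → ℝ} (hp : IsPMF p) (A : Ω → α) (B : Ω → β) (C : Ω → γ) :
    centNat p A (fun ω => (B ω, C ω)) ≤ centNat p A B := by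
  have := cmiNat_nonneg hp A B C
  simp only [centNat]; simp only [cmiNat] at this; linarith

/-- Subadditivity of conditional entropy. -/
lemma centNat_pi_le {n : ℕ} {p : Ω → ℝ} (hp : IsPMF p) (A : Ω → Fin n → α) (B : Ω → β) :
    centNat p A B ≤ ∑ i, centNat p (fun ω => A ω i) B := by
  have key : ∀ s : Finset (Fin n),
      centNat p (fun ω (j : Fin n) => if j ∈ s then some (A ω j) else none) B ≤
        ∑ i ∈ s, centNat p (fun ω => A ω i) B := by
    intro s
    induction s using Finset.induction_on with
    | empty =>
      have : ent p (fun ω => ((fun j : Fin n => if j ∈ (∅ : Finset (Fin n)) then some (A ω j)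
          else none), B ω)) = ent p B := ent_congr p (by simp)
      simp only [centNat, this, Finset.sum_empty, sub_self, le_refl]
    | insert i s hi ih =>
      rw [Finset.sum_insert hi]
      have h := cmiNat_nonneg hp (fun ω => A ω i) B
        (fun ω (j : Fin n) => if j ∈ s then some (A ω j) else none)
      have e1 : ent p (fun ω => (B ω, (fun j : Fin n => if j ∈ s then some (A ω j) else none))) =
          ent p (fun ω => ((fun j : Fin n => if j ∈ s then some (A ω j) else none), B ω)) :=
        ent_congr p (by simp only [Prod.mk.injEq]; tauto)
      have e2 : ent p (fun ω => (A ω i, B ω,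
          (fun j : Fin n => if j ∈ s then some (A ω j) else none))) =
          ent p (fun ω => ((fun j : Fin n => if j ∈ insert i s then some (A ω j) else none),
            B ω)) := by
        refine ent_congr p fun a a' => ?_
        have : ((fun j : Fin n => if j ∈ insert i s then some (A a j) else none) =
            fun j : Fin n => if j ∈ insert i s then some (A a' j) else none) ↔
            A a i = A a' i ∧ ((fun j : Fin n => if j ∈ s then some (A a j) else none) =
            fun j : Fin n => if j ∈ s then some (A a' j) else none) := by
          simp only [funext_iff]
          have hs : ∀ (t : Finset (Fin n)) j, ((if j ∈ t then some (A a j) else none) =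
              if j ∈ t then some (A a' j) else none) ↔ (j ∈ t → A a j = A a' j) := by
            intro t j; split_ifs with h <;> simp [h]
          simp only [hs]
          simp only [Finset.mem_insert, forall_eq_or_imp]
        simp only [Prod.mk.injEq, this]; tauto
      simp only [centNat] at ih ⊢
      simp only [cmiNat, e1, e2] at h
      linarith
  have := key Finset.univ
  have e : ent p (fun ω => ((fun j : Fin n => if j ∈ Finset.univ then some (A ω j) else none),
      B ω)) = ent p (fun ω => (A ω, B ω)) := ent_congr p (by simp [funext_iff])
  simpa only [centNat, e] using this

lemma sum_prod_erase {n : ℕ} {r : α → ℝ} (hr : ∑ a, r a = 1) (i : Fin n) (g : α → ℝ) :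
    ∑ w : Fin n → α, g (w i) * ∏ j ∈ Finset.univ.erase i, r (w j) = ∑ a, g a := by
  have h := Finset.prod_univ_sum (fun _ : Fin n => (Finset.univ : Finset α))
    (fun j a => if j = i then g a else r a)
  rw [Fintype.piFinset_univ] at h
  have e1 : ∏ j, ∑ a, (if j = i then g a else r a) = ∑ a, g a := by
    rw [Finset.prod_eq_single i (fun j _ hj => by simp [hj, hr]) (by simp)]
    simp
  rw [e1] at h
  rw [h]
  refine Finset.sum_congr rfl fun w _ => ?_
  rw [← Finset.mul_prod_erase _ _ (Finset.mem_univ i), if_pos rfl]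
  congr 1
  exact Finset.prod_congr rfl fun j hj => by rw [if_neg (Finset.ne_of_mem_erase hj)]

lemma marg_prod {n : ℕ} {r : α → ℝ} (hr : ∑ a, r a = 1) (i : Fin n) :
    marg (fun w : Fin n → α => ∏ j, r (w j)) (fun w => w i) = r := by
  funext a
  have := sum_prod_erase hr i (fun b => if b = a then r b else 0)
  simp only [Finset.sum_ite_eq', Finset.mem_univ, if_true] at this
  rw [← this, marg]
  refine Finset.sum_congr rfl fun w _ => ?_
  rw [ite_mul, zero_mul, Finset.mul_prod_erase _ (fun j => r (w j)) (Finset.mem_univ i)]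

lemma isPMF_prod {n : ℕ} {r : α → ℝ} (hr : IsPMF r) :
    IsPMF (fun w : Fin n → α => ∏ j, r (w j)) := by
  refine ⟨fun w => Finset.prod_nonneg fun j _ => hr.1 _, ?_⟩
  have h := Finset.prod_univ_sum (fun _ : Fin n => (Finset.univ : Finset α)) (fun _ a => r a)
  rw [Fintype.piFinset_univ] at h
  rw [← h]; simp [hr.2]

lemma negMulLog_prod {ι : Type*} [DecidableEq ι] (s : Finset ι) (x : ι → ℝ) :
    negMulLog (∏ i ∈ s, x i) = ∑ i ∈ s, negMulLog (x i) * ∏ j ∈ s.erase i, x j := by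
  induction s using Finset.induction_on with
  | empty => simp
  | insert a s ha ih =>
    rw [Finset.prod_insert ha, negMulLog_mul, Finset.sum_insert ha, Finset.erase_insert ha, ih,
      Finset.mul_sum, mul_comm]
    congr 1
    refine Finset.sum_congr rfl fun i hi => ?_
    have : a ≠ i := fun h => ha (h ▸ hi)
    rw [Finset.erase_insert_of_ne this, Finset.prod_insert (by simp [ha])]
    ring

lemma ent_id (r : α → ℝ) : ent r (fun a => a) = ∑ a, negMulLog (r a) := by
  rw [ent_eq_sum]
  refine Finset.sum_congr rfl fun a _ => ?_
  rw [marg_apply_of_injective r (f := fun a => a) (fun _ _ h => h) a]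

/-- Additivity of entropy for i.i.d. sequences. -/
lemma ent_prod {n : ℕ} {r : α → ℝ} (hr : ∑ a, r a = 1) :
    ent (fun w : Fin n → α => ∏ j, r (w j)) (fun w => w) = n * ent r (fun a => a) := by
  rw [ent_id, ent_id]
  rw [Finset.sum_congr rfl fun w _ => negMulLog_prod Finset.univ fun j => r (w j),
    Finset.sum_comm]
  simp only [sum_prod_erase hr _ fun a => negMulLog (r a), Finset.sum_const, Finset.card_univ,
    Fintype.card_fin, nsmul_eq_mul]

end Sequences

section Convexity

/-- In finite dimension, the convex hull of a compact set is compact. -/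
lemma isCompact_convexHull_of_isCompact {E : Type*} [NormedAddCommGroup E] [NormedSpace ℝ E]
    [FiniteDimensional ℝ E] {s : Set E} (hs : IsCompact s) : IsCompact (convexHull ℝ s) := by
  set N := Module.finrank ℝ E + 1
  have himg : convexHull ℝ s = (fun q : (Fin N → ℝ) × (Fin N → E) => ∑ i, q.1 i • q.2 i) ''
      (stdSimplex ℝ (Fin N) ×ˢ Set.univ.pi fun _ => s) := by
    apply Set.Subset.antisymm
    · intro x hx
      obtain ⟨ι, _, z, w, hz, hind, hw, hw1, rfl⟩ := eq_pos_convex_span_of_mem_convexHull hx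
      have hcard : Fintype.card ι ≤ N :=
        hind.card_le_finrank_succ.trans (Nat.succ_le_succ (Submodule.finrank_le _))
      have hne : Nonempty ι := by
        by_contra h
        rw [not_nonempty_iff] at h
        simp at hw1
      obtain ⟨f⟩ : Nonempty (ι ↪ Fin N) := Function.Embedding.nonempty_of_card_le (by simpa)
      have hext : ∀ j, j ∉ Set.range f → Function.extend f w 0 j = 0 := fun j hj =>
        Function.extend_apply' _ _ _ (by simpa using hj)
      refine ⟨(Function.extend f w 0, Function.extend f z fun _ => z hne.some), ⟨⟨fun j => ?_, ?_⟩,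
        fun j _ => ?_⟩, ?_⟩
      · by_cases hj : j ∈ Set.range f
        · obtain ⟨i, rfl⟩ := hj
          simpa [f.injective.extend_apply] using (hw i).le
        · exact (hext j hj).ge
      · rw [← hw1]
        exact (Fintype.sum_of_injective f f.injective _ _ hext
          fun i => (f.injective.extend_apply ..).symm).symm
      · by_cases hj : j ∈ Set.range f
        · obtain ⟨i, rfl⟩ := hj
          simpa [f.injective.extend_apply] using hz ⟨i, rfl⟩
        · have : Function.extend f z (fun _ => z hne.some) j = z hne.some :=
            Function.extend_apply' _ _ _ (by simpa using hj)
          simpa [this] using hz ⟨_, rfl⟩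
      · exact (Fintype.sum_of_injective f f.injective _ _ (fun j hj => by simp [hext j hj])
          fun i => by simp [f.injective.extend_apply]).symm
    · rintro _ ⟨⟨w, z⟩, ⟨⟨hw0, hw1⟩, hz⟩, rfl⟩
      exact mem_convexHull_of_exists_fintype w z hw0 hw1 (fun i => hz i (Set.mem_univ i)) rfl
  rw [himg]
  refine ((isCompact_stdSimplex ℝ _).prod (isCompact_univ_pi fun _ => hs)).image ?_
  fun_prop

end Convexity

section Strategies

open Real

variable {𝒳 𝒴 𝒵 : Type*} [Fintype 𝒳] [Fintype 𝒴] [Fintype 𝒵]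

/-- Conditional entropy of the first coordinate given the second one, as a function of a
(not necessarily normalized) weight function. -/
noncomputable def condFst {α β : Type*} [Fintype α] [Fintype β] (r : α × β → ℝ) : ℝ :=
  ∑ w, negMulLog (r w) - ∑ b, negMulLog (∑ a, r (a, b))

lemma condFst_smul {α β : Type*} [Fintype α] [Fintype β] (c : ℝ) (r : α × β → ℝ) :
    condFst (c • r) = c * condFst r := by
  simp only [condFst, Pi.smul_apply, smul_eq_mul, ← Finset.mul_sum, negMulLog_mul,
    Finset.sum_add_distrib, ← Finset.sum_mul]
  rw [Fintype.sum_prod_type_right]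
  ring

lemma continuous_condFst {α β : Type*} [Fintype α] [Fintype β] :
    Continuous (condFst : (α × β → ℝ) → ℝ) := by
  unfold condFst; fun_prop

lemma condFst_eq {α β : Type*} [Fintype α] [Fintype β] (r : α × β → ℝ) :
    condFst r = ent r (fun w => w) - ent r (fun w => w.2) := by
  rw [ent_id, ent_eq_sum, condFst]
  congr 2; funext b; congr 1
  simp only [marg, Fintype.sum_prod_type]
  simp

lemma sum_condFst_eq {U α β : Type*} [Fintype U] [Fintype α] [Fintype β] (J : U × α × β → ℝ) :
    ∑ u, condFst (fun w => J (u, w)) = ent J (fun w => w) - ent J (fun w => (w.1, w.2.2)) := by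
  rw [ent_id, ent_eq_sum]
  simp only [condFst, Finset.sum_sub_distrib]
  rw [Fintype.sum_prod_type, Fintype.sum_prod_type]
  congr 2; funext u; congr 1; funext b; congr 1
  simp only [marg, Fintype.sum_prod_type, Prod.mk.injEq, ite_and]
  simp [Finset.sum_ite_irrel]

/-- The joint weights of `(X, Y, Z)` when a message has likelihood `e x` and is decoded by `d`. -/
def strat (p : 𝒳 × 𝒴 → ℝ) (e : 𝒳 → ℝ) (d : 𝒴 → 𝒵 → ℝ) : 𝒳 × 𝒴 × 𝒵 → ℝ :=
  fun w => p (w.1, w.2.1) * e w.1 * d w.2.1 w.2.2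

/-- The statistics of a message that have to be averaged over all messages. -/
noncomputable def stratStat (p : 𝒳 × 𝒴 → ℝ) (e : 𝒳 → ℝ) (d : 𝒴 → 𝒵 → ℝ) :
    (𝒳 → ℝ) × (𝒳 × 𝒴 × 𝒵 → ℝ) × ℝ :=
  (e, strat p e d, condFst (strat p e d))

lemma stratStat_smul (p : 𝒳 × 𝒴 → ℝ) (c : ℝ) (e : 𝒳 → ℝ) (d : 𝒴 → 𝒵 → ℝ) :
    stratStat p (c • e) d = c • stratStat p e d := by
  have : strat p (c • e) d = c • strat p e d := by
    funext w; simp only [strat, Pi.smul_apply, smul_eq_mul]; ring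
  simp only [stratStat, this, condFst_smul, Prod.smul_mk, smul_eq_mul]

/-- Statistics that are approximately realized by an auxiliary variable are exactly realized. -/
lemma exists_strat_of_approx.{v} [Nonempty 𝒳] (p : 𝒳 × 𝒴 → ℝ) (r : 𝒳 × 𝒴 × 𝒵 → ℝ) (τ : ℝ)
    (H : ∀ δ > 0, ∃ (U : Type v) (_ : Fintype U) (e : U → 𝒳 → ℝ) (d : U → 𝒴 → 𝒵 → ℝ),
      (∀ x, IsPMF fun u => e u x) ∧ (∀ u y, IsPMF (d u y)) ∧
      (∀ w, |∑ u, strat p (e u) (d u) w - r w| ≤ δ) ∧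
      |∑ u, condFst (strat p (e u) (d u)) - τ| ≤ δ) :
    ∃ (k : ℕ) (e : Fin k → 𝒳 → ℝ) (d : Fin k → 𝒴 → 𝒵 → ℝ),
      (∀ x, IsPMF fun u => e u x) ∧ (∀ u y, IsPMF (d u y)) ∧
      (∀ w, ∑ u, strat p (e u) (d u) w = r w) ∧ ∑ u, condFst (strat p (e u) (d u)) = τ := by
  set K : Set ((𝒳 → ℝ) × (𝒴 → 𝒵 → ℝ)) :=
    stdSimplex ℝ 𝒳 ×ˢ Set.univ.pi fun _ => stdSimplex ℝ 𝒵
  set Φ : (𝒳 → ℝ) × (𝒴 → 𝒵 → ℝ) → (𝒳 → ℝ) × (𝒳 × 𝒴 × 𝒵 → ℝ) × ℝ := fun q => stratStat p q.1 q.2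
  have hΦ : Continuous Φ := by
    have h : Continuous fun q : (𝒳 → ℝ) × (𝒴 → 𝒵 → ℝ) => strat p q.1 q.2 := by
      unfold strat; fun_prop
    exact continuous_fst.prodMk (h.prodMk (continuous_condFst.comp h))
  have hK : IsCompact K :=
    (isCompact_stdSimplex ℝ _).prod (isCompact_univ_pi fun _ => isCompact_stdSimplex ℝ _)
  have hclosed := (isCompact_convexHull_of_isCompact (hK.image hΦ)).isClosed
  have hN : (0 : ℝ) < Fintype.card 𝒳 := by exact_mod_cast Fintype.card_pos
  set c : ℝ := (Fintype.card 𝒳 : ℝ)⁻¹ with hc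
  have hc0 : 0 < c := by positivity
  have hc1 : c ≤ 1 := inv_le_one_of_one_le₀ (by exact_mod_cast Fintype.card_pos (α := 𝒳))
  have hmem : c • ((1, r, τ) : (𝒳 → ℝ) × (𝒳 × 𝒴 × 𝒵 → ℝ) × ℝ) ∈ convexHull ℝ (Φ '' K) := by
    rw [← hclosed.closure_eq, Metric.mem_closure_iff]
    intro ε hε
    obtain ⟨U, _, e, d, he, hd, hJ, hh⟩ := H (ε / 2) (by positivity)
    refine ⟨∑ u, c • stratStat p (e u) (d u), ?_, ?_⟩
    · have hex : ∀ u, ∃ a ∈ stdSimplex ℝ 𝒳, (c * ∑ x, e u x) • a = c • e u := by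
        intro u
        rcases eq_or_ne (∑ x, e u x) 0 with h | h
        · refine ⟨_, single_mem_stdSimplex ℝ (Classical.arbitrary 𝒳), ?_⟩
          rw [Finset.sum_eq_zero_iff_of_nonneg fun x _ => (he x).1 u] at h
          have : e u = 0 := funext fun x => h x (Finset.mem_univ x)
          simp [this]
        · refine ⟨fun x => e u x / ∑ x, e u x, ⟨fun x => div_nonneg ((he x).1 u)
            (Finset.sum_nonneg fun x _ => (he x).1 u), ?_⟩, ?_⟩
          · rw [← Finset.sum_div, div_self h]
          · funext x; simp only [Pi.smul_apply, smul_eq_mul]; field_simp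
      choose a ha hae using hex
      refine mem_convexHull_of_exists_fintype (fun u => c * ∑ x, e u x) (fun u => Φ (a u, d u))
        (fun u => mul_nonneg hc0.le (Finset.sum_nonneg fun x _ => (he x).1 u)) ?_
        (fun u => Set.mem_image_of_mem _ ⟨ha u, fun y _ => hd u y⟩) ?_
      · rw [← Finset.mul_sum, Finset.sum_comm]
        simp only [(he _).2, hc]
        simp [hN.ne']
      · simp only [Φ, ← stratStat_smul, hae]
    · rw [← Finset.smul_sum, dist_eq_norm, ← smul_sub, norm_smul, Real.norm_of_nonneg hc0.le]
      refine lt_of_le_of_lt (mul_le_of_le_one_left (norm_nonneg _) hc1) ?_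
      refine lt_of_le_of_lt (b := ε / 2) ?_ (by linarith)
      have hε2 : 0 ≤ ε / 2 := by positivity
      rw [Prod.norm_def, Prod.norm_def]
      refine max_le ?_ (max_le ?_ ?_)
      · rw [pi_norm_le_iff_of_nonneg hε2]
        intro x
        simp [Prod.fst_sum, stratStat, (he x).2, hε2]
      · rw [pi_norm_le_iff_of_nonneg hε2]
        intro w
        have := hJ w
        rw [abs_sub_comm] at this
        simpa [Prod.fst_sum, Prod.snd_sum, stratStat] using this
      · rw [abs_sub_comm] at hh
        simpa [Prod.snd_sum, stratStat] using hh
  obtain ⟨ι, _, w, z, hw0, hw1, hz, hsum⟩ := mem_convexHull_iff_exists_fintype.mp hmem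
  choose q hq hqz using hz
  let g := (Fintype.equivFin ι).symm
  let e : ι → 𝒳 → ℝ := fun i => (Fintype.card 𝒳 * w i) • (q i).1
  have hstat : ∑ i, stratStat p (e i) (q i).2 = (1, r, τ) := by
    simp only [e, stratStat_smul, mul_smul, ← Finset.smul_sum]
    have : ∑ i, w i • stratStat p (q i).1 (q i).2 = ∑ i, w i • z i := by simp only [← hqz, Φ]
    rw [this, hsum, hc, smul_inv_smul₀ hN.ne']
  have h1 := congrArg Prod.fst hstat
  have h2 := congrArg (fun v => v.2.1) hstat
  have h3 := congrArg (fun v => v.2.2) hstat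
  simp only [Prod.fst_sum, Prod.snd_sum, stratStat] at h1 h2 h3
  refine ⟨Fintype.card ι, fun u => e (g u), fun u => (q (g u)).2, fun x => ⟨fun u => ?_, ?_⟩,
    fun u y => (hq (g u)).2 y (Set.mem_univ y), fun v => ?_, ?_⟩
  · exact mul_nonneg (mul_nonneg hN.le (hw0 _)) ((hq _).1.1 x)
  · rw [g.sum_comp fun i => e i x]
    simpa using congrFun h1 x
  · rw [g.sum_comp fun i => strat p (e i) (q i).2 v]
    simpa using congrFun h2 v
  · rw [g.sum_comp fun i => condFst (strat p (e i) (q i).2)]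
    exact h3

/-- An exact realization of the statistics of `p_XYZ` yields perfect security. -/
lemma perfectlySecure_of_strat {p : 𝒳 × 𝒴 → ℝ} {Q : 𝒳 → 𝒴 → 𝒵 → ℝ} (hp : IsPMF p)
    (hQ : ∀ x y, IsPMF (Q x y)) {k : ℕ} {e : Fin k → 𝒳 → ℝ} {d : Fin k → 𝒴 → 𝒵 → ℝ}
    (he : ∀ x, IsPMF fun u => e u x) (hd : ∀ u y, IsPMF (d u y))
    (hJ : ∀ w, ∑ u, strat p (e u) (d u) w = jointXYZ p Q w)
    (hh : ∑ u, condFst (strat p (e u) (d u)) = condFst (jointXYZ p Q)) :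
    PerfectlySecure p Q := by
  set r := jointXYZ p Q
  set J : Fin k × 𝒳 × 𝒴 × 𝒵 → ℝ := fun w => strat p (e w.1) (d w.1) w.2 with hJdef
  have hJ0 : ∀ w, 0 ≤ J w := fun w =>
    mul_nonneg (mul_nonneg (hp.1 _) ((he _).1 _)) ((hd _ _).1 _)
  let pU : 𝒳 × 𝒴 × 𝒵 → Fin k → ℝ := fun w u => if r w = 0 then e u w.1 else J (u, w) / r w
  have hjoint : jointU p Q pU = J := by
    funext ⟨u, w⟩
    simp only [jointU, pU]
    change r w * _ = _
    split_ifs with h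
    · rw [h, zero_mul]
      have := hJ w
      rw [h, Finset.sum_eq_zero_iff_of_nonneg fun u _ => hJ0 (u, w)] at this
      exact (this u (Finset.mem_univ u)).symm
    · field_simp
  have hr0 : ∀ w, 0 ≤ r w := fun w => mul_nonneg (hp.1 _) ((hQ _ _).1 _)
  have hJpmf : IsPMF J := by
    refine ⟨hJ0, ?_⟩
    rw [Fintype.sum_prod_type_right]
    simp only [hJdef, hJ, r, jointXYZ, Fintype.sum_prod_type, ← Finset.mul_sum, (hQ _ _).2, mul_one]
    rw [← Fintype.sum_prod_type', hp.2]
  have hmr : marg J (fun w => w.2) = r := by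
    funext w
    rw [← hJ w]
    simp only [marg]
    rw [Fintype.sum_prod_type]
    simp [hJdef]
  refine ⟨k, pU, fun w => ⟨fun u => ?_, ?_⟩, ?_⟩
  · simp only [pU]; split_ifs
    · exact (he _).1 u
    · exact div_nonneg (hJ0 _) (hr0 _)
  · simp only [pU]; split_ifs with h
    · exact (he _).2
    · rw [← Finset.sum_div, hJ, div_self h]
  · rw [hjoint, cmi_eq_zero_iff, cmi_eq_zero_iff, cmi_eq_zero_iff]
    refine ⟨?_, ?_, ?_⟩
    · refine cmiNat_eq_zero_of_factor hJpmf _ _ _ e (fun x y => p (x, y)) fun u x y => ?_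
      rw [← marg_snd_eq J (fun w => (w.1, w.2.1, w.2.2.1)) (fun w => w.2.2.2)]
      have : ∀ z, marg J (fun w => ((w.1, w.2.1, w.2.2.1), w.2.2.2)) ((u, x, y), z) =
          e u x * p (x, y) * d u y z := fun z => by
        rw [marg_apply_of_injective J (f := fun w => ((w.1, w.2.1, w.2.2.1), w.2.2.2))
          (fun _ _ h => by simp only [Prod.ext_iff] at h ⊢; tauto) (u, x, y, z)]
        simp only [hJdef, strat]; ring
      simp only [this, ← Finset.mul_sum, (hd _ _).2, mul_one]
    · refine cmiNat_eq_zero_of_factor hJpmf _ _ _ (fun z b => d b.1 b.2 z)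
        (fun b x => p (x, b.2) * e b.1 x) fun z b x => ?_
      rw [marg_apply_of_injective J (f := fun w => (w.2.2.2, (w.1, w.2.2.1), w.2.1))
          (fun _ _ h => by simp only [Prod.ext_iff] at h ⊢; tauto) (b.1, x, b.2, z)]
      simp only [hJdef, strat]; ring
    · have e1 := sum_condFst_eq J
      have e2 := condFst_eq r
      rw [← hmr, ent_marg, ent_marg, hmr] at e2
      have e3 : ent J (fun w => (w.1, (w.2.2.1, w.2.2.2), w.2.1)) = ent J (fun w => w) :=
        ent_congr J fun a a' => by simp only [Prod.ext_iff]; tauto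
      have e4 : ent J (fun w => ((w.2.2.1, w.2.2.2), w.2.1)) = ent J (fun w => w.2) :=
        ent_congr J fun a a' => by simp only [Prod.ext_iff]; tauto
      simp only [cmiNat, e3, e4]
      change ∑ u, condFst (strat p (e u) (d u)) = _ at e1
      linarith

end Strategies

section OneShot

open Real

/-- A Markov chain `A - B - C` lets one generate `A` from `B` alone. -/
lemma exists_kernel_of_cmiNat_eq_zero {Ω α β γ : Type*} [Fintype Ω] [Fintype α] [Fintype β]
    [Fintype γ] [Nonempty α] {p : Ω → ℝ} (hp : IsPMF p) (A : Ω → α) (B : Ω → β) (C : Ω → γ)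
    (h : cmiNat p A B C = 0) :
    ∃ κ : β → α → ℝ, (∀ b, IsPMF (κ b)) ∧ ∀ a b c,
      marg p (fun ω => (A ω, B ω, C ω)) (a, b, c) = κ b a * marg p (fun ω => (B ω, C ω)) (b, c) := by
  rw [cmiNat_eq_zero_iff hp] at h
  have hAB : ∀ b, ∑ a, marg p (fun ω => (A ω, B ω)) (a, b) = marg p B b := marg_fst_eq p A B
  have hB0 : ∀ b, 0 ≤ marg p B b := marg_nonneg hp.1 B
  refine ⟨fun b a => if marg p B b = 0 then (Fintype.card α : ℝ)⁻¹ else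
    marg p (fun ω => (A ω, B ω)) (a, b) / marg p B b, fun b => ⟨fun a => ?_, ?_⟩, fun a b c => ?_⟩
  · dsimp only
    split_ifs
    · positivity
    · exact div_nonneg (marg_nonneg hp.1 _ _) (hB0 b)
  · dsimp only
    split_ifs with hb
    · simp
    · rw [← Finset.sum_div, hAB, div_self hb]
  · have h1 := marg_fst_eq p A (fun ω => (B ω, C ω)) (b, c)
    have h2 := marg_snd_eq p B C b
    have h3 : marg p (fun ω => (A ω, B ω, C ω)) (a, b, c) ≤ marg p (fun ω => (B ω, C ω)) (b, c) :=
      h1 ▸ Finset.single_le_sum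
        (f := fun a => marg p (fun ω => (A ω, B ω, C ω)) (a, b, c))
        (fun _ _ => marg_nonneg hp.1 _ _) (Finset.mem_univ a)
    have h4 : marg p (fun ω => (B ω, C ω)) (b, c) ≤ marg p B b :=
      h2 ▸ Finset.single_le_sum (f := fun c => marg p (fun ω => (B ω, C ω)) (b, c))
        (fun _ _ => marg_nonneg hp.1 _ _) (Finset.mem_univ c)
    dsimp only
    split_ifs with hb
    · have h5 : marg p (fun ω => (B ω, C ω)) (b, c) = 0 :=
        le_antisymm (hb ▸ h4) (marg_nonneg hp.1 _ _)
      rw [h5, mul_zero]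
      exact le_antisymm (h5 ▸ h3) (marg_nonneg hp.1 _ _)
    · have := h a b c
      field_simp
      linarith

variable {𝒳 𝒴 𝒵 : Type*} [Fintype 𝒳] [Fintype 𝒴] [Fintype 𝒵]

lemma isPMF_jointXYZ {p : 𝒳 × 𝒴 → ℝ} {Q : 𝒳 → 𝒴 → 𝒵 → ℝ} (hp : IsPMF p)
    (hQ : ∀ x y, IsPMF (Q x y)) : IsPMF (jointXYZ p Q) := by
  refine ⟨fun w => mul_nonneg (hp.1 _) ((hQ _ _).1 _), ?_⟩
  simp only [jointXYZ, Fintype.sum_prod_type, ← Finset.mul_sum, (hQ _ _).2, mul_one]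
  rw [← Fintype.sum_prod_type', hp.2]

lemma isPMF_jointU {p : 𝒳 × 𝒴 → ℝ} {Q : 𝒳 → 𝒴 → 𝒵 → ℝ} (hp : IsPMF p)
    (hQ : ∀ x y, IsPMF (Q x y)) {k : ℕ} {pU : 𝒳 × 𝒴 × 𝒵 → Fin k → ℝ} (hU : ∀ w, IsPMF (pU w)) :
    IsPMF (jointU p Q pU) := by
  have hr := isPMF_jointXYZ hp hQ
  refine ⟨fun w => mul_nonneg (hr.1 _) ((hU _).1 _), ?_⟩
  rw [Fintype.sum_prod_type_right, ← hr.2]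
  simp only [jointU, ← Finset.mul_sum, (hU _).2, mul_one]

/-- Perfect security gives an encoder and a decoder realizing `p_XYZ` exactly. -/
lemma exists_strat_of_secureAux [Nonempty 𝒵] {p : 𝒳 × 𝒴 → ℝ} {Q : 𝒳 → 𝒴 → 𝒵 → ℝ}
    (hp : IsPMF p) (hQ : ∀ x y, IsPMF (Q x y)) {k : ℕ} [Nonempty (Fin k)]
    {pU : 𝒳 × 𝒴 × 𝒵 → Fin k → ℝ} (h : SecureAux p Q pU) :
    ∃ (e : 𝒳 → Fin k → ℝ) (d : Fin k × 𝒴 → 𝒵 → ℝ), (∀ x, IsPMF (e x)) ∧ (∀ v, IsPMF (d v)) ∧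
      ∀ u x y z, jointU p Q pU (u, x, y, z) = p (x, y) * e x u * d (u, y) z := by
  obtain ⟨hU, h1, h2, -⟩ := h
  have hJ := isPMF_jointU hp hQ hU
  rw [cmi_eq_zero_iff] at h1 h2
  obtain ⟨e, he, h1⟩ := exists_kernel_of_cmiNat_eq_zero hJ _ _ _ h1
  obtain ⟨d, hd, h2⟩ := exists_kernel_of_cmiNat_eq_zero hJ _ _ _ h2
  refine ⟨e, d, he, hd, fun u x y z => ?_⟩
  set J := jointU p Q pU with hJdef
  have a1 : marg J (fun w => (w.2.2.2, (w.1, w.2.2.1), w.2.1)) (z, (u, y), x) = J (u, x, y, z) :=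
    marg_apply_of_injective J (f := fun w => (w.2.2.2, (w.1, w.2.2.1), w.2.1))
      (fun _ _ h => by simp only [Prod.ext_iff] at h ⊢; tauto) (u, x, y, z)
  have a2 : marg J (fun w => ((w.1, w.2.2.1), w.2.1)) ((u, y), x) =
      marg J (fun w => (w.1, w.2.1, w.2.2.1)) (u, x, y) := by
    simp only [marg, Prod.mk.injEq, and_assoc, and_comm (a := _ = y)]
  have a3 : marg J (fun w => (w.2.1, w.2.2.1)) (x, y) = p (x, y) := by
    simp only [marg, hJdef, jointU]
    rw [Fintype.sum_prod_type_right]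
    simp only [← ite_zero_mul, ← Finset.mul_sum, (hU _).2, mul_one]
    simp only [Fintype.sum_prod_type, Prod.mk.injEq, ite_and, jointXYZ]
    simp [Finset.sum_ite_irrel, ← Finset.mul_sum, (hQ _ _).2]
  rw [← a1, h2, a2, h1, a3]; ring

lemma isPMF_uniform (α : Type*) [Fintype α] [Nonempty α] :
    IsPMF fun _ : α => (Fintype.card α : ℝ)⁻¹ :=
  ⟨fun _ => by positivity, by simp⟩

lemma msgCard_pos (n : ℕ) (R : ℝ) : 0 < msgCard n R :=
  Nat.ceil_pos.mpr (Real.rpow_pos_of_pos two_pos _)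

lemma exists_msgCard_one_eq {k : ℕ} (hk : 0 < k) : ∃ R, 0 ≤ R ∧ k = msgCard 1 R := by
  refine ⟨Real.logb 2 k, Real.logb_nonneg one_lt_two (by exact_mod_cast hk), ?_⟩
  rw [msgCard, Nat.cast_one, one_mul,
    Real.rpow_logb two_pos (by norm_num) (by exact_mod_cast hk), Nat.ceil_natCast]

/-- A perfectly secure auxiliary variable is itself a one-shot message. -/
lemma securelyAchievable_of_secureAux [Nonempty 𝒵] {p : 𝒳 × 𝒴 → ℝ} {Q : 𝒳 → 𝒴 → 𝒵 → ℝ}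
    (hp : IsPMF p) (hQ : ∀ x y, IsPMF (Q x y)) {R : ℝ} (hR : 0 ≤ R)
    {pU : 𝒳 × 𝒴 × 𝒵 → Fin (msgCard 1 R) → ℝ} (h : SecureAux p Q pU) :
    SecurelyAchievable p Q R := by
  have hne : ∀ n, Nonempty (Fin (msgCard n R)) := fun n => ⟨⟨0, msgCard_pos n R⟩⟩
  obtain ⟨e, d, he, hd, hed⟩ := exists_strat_of_secureAux hp hQ h
  set J := jointU p Q pU with hJdef
  let enc : (n : ℕ) → (Fin n → 𝒳) → Fin (msgCard n R) → ℝ :=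
    Function.update (fun n _ _ => (Fintype.card (Fin (msgCard n R)) : ℝ)⁻¹) 1 fun xs => e (xs 0)
  let dec : (n : ℕ) → Fin (msgCard n R) → (Fin n → 𝒴) → (Fin n → 𝒵) → ℝ :=
    Function.update (fun n _ _ _ => (Fintype.card (Fin n → 𝒵) : ℝ)⁻¹) 1
      fun m ys zs => d (m, ys 0) (zs 0)
  have enc1 : enc 1 = fun xs => e (xs 0) := Function.update_self ..
  have dec1 : dec 1 = fun m ys zs => d (m, ys 0) (zs 0) := Function.update_self ..
  refine ⟨hR, enc, dec, fun n xs => ?_, fun n m ys => ?_, fun ε hε => ⟨1, one_pos, ?_, ?_⟩⟩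
  · rcases eq_or_ne n 1 with rfl | hn
    · rw [enc1]; exact he _
    · simp only [enc, Function.update_of_ne hn]; exact isPMF_uniform _
  · rcases eq_or_ne n 1 with rfl | hn
    · rw [dec1]
      refine ⟨fun zs => (hd _).1 _, ?_⟩
      rw [← (hd (m, ys 0)).2]
      exact Fintype.sum_equiv (Equiv.funUnique (Fin 1) 𝒵) _ _ fun zs => rfl
    · simp only [dec, Function.update_of_ne hn]; exact isPMF_uniform _
  all_goals
    have hP : ∀ xs ys m zs, inducedPMF p 1 R (enc 1) (dec 1) (xs, ys, m, zs) =
        J (m, xs 0, ys 0, zs 0) := fun xs ys m zs => by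
      simp [inducedPMF, enc1, dec1, hed]
  · have : ∀ w : (Fin 1 → 𝒳) × (Fin 1 → 𝒴) × (Fin 1 → 𝒵),
        ∑ m, inducedPMF p 1 R (enc 1) (dec 1) (w.1, w.2.1, m, w.2.2) = prodXYZ p Q 1 w := by
      intro w
      simp only [hP, prodXYZ, hJdef, jointU, ← Finset.mul_sum, (h.1 _).2]
      simp
    simp only [tv, this, sub_self, abs_zero, Finset.sum_const_zero, mul_zero]
    exact hε.le
  · set P := inducedPMF p 1 R (enc 1) (dec 1)
    let φ : (Fin 1 → 𝒳) × (Fin 1 → 𝒴) × Fin (msgCard 1 R) × (Fin 1 → 𝒵) →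
        Fin (msgCard 1 R) × 𝒳 × 𝒴 × 𝒵 := fun w => (w.2.2.1, w.1 0, w.2.1 0, w.2.2.2 0)
    have hφ : Function.Injective φ := fun a b h => by
      simp only [φ, Prod.ext_iff, funext_iff, Fin.forall_fin_one] at h ⊢; tauto
    have hm : marg P φ = J := by
      funext ⟨u, x, y, z⟩
      have := marg_apply_of_injective P hφ (fun _ => x, fun _ => y, u, fun _ => z)
      rw [hP] at this
      exact this
    have h3 := h.2.2.2
    rw [cmi_eq_zero_iff] at h3
    have : cmiNat P (fun w => w.2.2.1) (fun w => (w.2.1, w.2.2.2)) (fun w => w.1) = 0 := by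
      rw [← h3, ← hJdef, ← hm]
      simp only [cmiNat, ent_marg]
      congr 1; congr 1; congr 1
      all_goals
        refine ent_congr P fun a b => ?_
        simp only [φ, Prod.ext_iff, funext_iff, Fin.forall_fin_one]
    rw [(cmi_eq_zero_iff ..).mpr this]
    positivity

end OneShot

section AlmostProduct

open Real

variable {α β : Type*} [Fintype α]

lemma marg_prod_comp {n : ℕ} (r : α → ℝ) (f : α → β) :
    marg (fun w : Fin n → α => ∏ j, r (w j)) (fun w j => f (w j)) =
      fun v => ∏ j, marg r f (v j) := by
  funext v
  have h := Finset.prod_univ_sum (fun _ : Fin n => (Finset.univ : Finset α))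
    (fun j a => if f a = v j then r a else 0)
  rw [Fintype.piFinset_univ] at h
  simp only [marg, h]
  refine Finset.sum_congr rfl fun w _ => ?_
  simp only [Finset.prod_ite_zero, funext_iff, Finset.mem_univ, true_imp_iff]

variable [Fintype β]

lemma ent_prod_comp {n : ℕ} {r : α → ℝ} (hr : IsPMF r) (f : α → β) :
    ent (fun w : Fin n → α => ∏ j, r (w j)) (fun w j => f (w j)) = n * ent r f := by
  have h1 := ent_marg (fun w : Fin n → α => ∏ j, r (w j)) (fun w j => f (w j)) (fun v => v)
  rw [← h1, marg_prod_comp, ent_prod (hr.marg f).2, ent_marg]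

lemma entModulus_mul_le {n : ℕ} (hn : 0 < n) (c : ℝ) {t : ℝ} (h0 : 0 ≤ t) (h1 : t ≤ 1) :
    entModulus (n * c) t ≤ n * entModulus c t := by
  have hn' : (1 : ℝ) ≤ n := by exact_mod_cast hn
  have := negMulLog_nonneg h0 h1
  simp only [entModulus]
  nlinarith

variable {n : ℕ} {r : α → ℝ} {ρ : (Fin n → α) → ℝ} {θ δ : ℝ}

lemma abs_ent_pi_sub_le [Nonempty β] (hn : 0 < n) (hr : IsPMF r) (hρ : IsPMF ρ)
    (hθ1 : θ ≤ 1) (hθ : ∀ t, 0 ≤ t → t ≤ θ → entModulus (log (Fintype.card α)) t ≤ δ)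
    (hclose : ∑ w, |ρ w - ∏ j, r (w j)| ≤ θ) (f : α → β)
    (hcard : Fintype.card β ≤ Fintype.card α) :
    |ent ρ (fun w j => f (w j)) - n * ent r f| ≤ n * δ := by
  rw [← ent_prod_comp hr f]
  have hpos : (0 : ℝ) < Fintype.card β := by exact_mod_cast Fintype.card_pos
  obtain ⟨t, h0, h1, h2⟩ := abs_ent_sub_le hρ (isPMF_prod hr) (fun w j => f (w j))
    (L := n * log (Fintype.card α)) (by
      rw [Fintype.card_pi_const, Nat.cast_pow, log_pow]
      gcongr)
  have h3 := h1.trans hclose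
  refine h2.trans ((entModulus_mul_le hn _ h0 (h3.trans hθ1)).trans ?_)
  exact mul_le_mul_of_nonneg_left (hθ t h0 h3) (Nat.cast_nonneg n)

lemma abs_ent_apply_sub_le [Nonempty β] (hr : IsPMF r) (hρ : IsPMF ρ)
    (hθ : ∀ t, 0 ≤ t → t ≤ θ → entModulus (log (Fintype.card α)) t ≤ δ)
    (hclose : ∑ w, |ρ w - ∏ j, r (w j)| ≤ θ) (f : α → β)
    (hcard : Fintype.card β ≤ Fintype.card α) (i : Fin n) :
    |ent ρ (fun w => f (w i)) - ent r f| ≤ δ := by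
  have h : ent (fun w : Fin n → α => ∏ j, r (w j)) (fun w => f (w i)) = ent r f := by
    rw [← ent_marg (fun w : Fin n → α => ∏ j, r (w j)) (fun w => w i) f, marg_prod hr.2]
  have hpos : (0 : ℝ) < Fintype.card β := by exact_mod_cast Fintype.card_pos
  obtain ⟨t, h0, h1, h2⟩ := abs_ent_sub_le hρ (isPMF_prod hr) (fun w => f (w i))
    (L := log (Fintype.card α)) (by gcongr)
  rw [h] at h2
  exact h2.trans (hθ t h0 (h1.trans hclose))

lemma abs_marg_apply_sub_le (hr : IsPMF r) (hclose : ∑ w, |ρ w - ∏ j, r (w j)| ≤ θ) (i : Fin n)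
    (a : α) : |marg ρ (fun w => w i) a - r a| ≤ θ := by
  rw [← congrFun (marg_prod hr.2 i) a]
  simp only [marg, ← Finset.sum_sub_distrib]
  refine (Finset.abs_sum_le_sum_abs _ _).trans (le_trans (Finset.sum_le_sum fun w _ => ?_) hclose)
  split_ifs <;> simp

end AlmostProduct

section SingleLetter

open Real

variable {𝒳 𝒴 𝒵 : Type*} [Fintype 𝒳] [Fintype 𝒴] [Fintype 𝒵]

lemma isPMF_inducedPMF {p : 𝒳 × 𝒴 → ℝ} (hp : IsPMF p) {n : ℕ} {R : ℝ}
    {enc : (Fin n → 𝒳) → Fin (msgCard n R) → ℝ}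
    {dec : Fin (msgCard n R) → (Fin n → 𝒴) → (Fin n → 𝒵) → ℝ}
    (henc : ∀ xs, IsPMF (enc xs)) (hdec : ∀ m ys, IsPMF (dec m ys)) :
    IsPMF (inducedPMF p n R enc dec) := by
  refine ⟨fun w => mul_nonneg (mul_nonneg (Finset.prod_nonneg fun i _ => hp.1 _) ((henc _).1 _))
    ((hdec _ _).1 _), ?_⟩
  rw [← (isPMF_prod (n := n) hp).2]
  simp only [inducedPMF, Fintype.sum_prod_type, ← Finset.mul_sum, (hdec _ _).2, mul_one,
    (henc _).2]
  rw [← Fintype.sum_prod_type']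
  exact Fintype.sum_equiv (Equiv.arrowProdEquivProdArrow (Fin n) (fun _ => 𝒳) fun _ => 𝒴).symm _ _
    fun w => rfl

/-- Likelihood of the auxiliary message `(m, v)`, with `v` the data of the decoder outside `i`. -/
noncomputable def auxEnc (p : 𝒳 × 𝒴 → ℝ) {n : ℕ} {R : ℝ}
    (enc : (Fin n → 𝒳) → Fin (msgCard n R) → ℝ) (i : Fin n) (y₀ : 𝒴)
    (u : Fin (msgCard n R) × (Fin n → 𝒴)) (x : 𝒳) : ℝ :=
  ∑ xs : Fin n → 𝒳, if xs i = x ∧ u.2 i = y₀ then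
    (∏ j ∈ Finset.univ.erase i, p (xs j, u.2 j)) * enc xs u.1 else 0

/-- Decoder of the `i`-th letter from the auxiliary message `(m, v)`. -/
noncomputable def auxDec {n : ℕ} {R : ℝ}
    (dec : Fin (msgCard n R) → (Fin n → 𝒴) → (Fin n → 𝒵) → ℝ) (i : Fin n)
    (u : Fin (msgCard n R) × (Fin n → 𝒴)) (y : 𝒴) : 𝒵 → ℝ :=
  marg (dec u.1 (Function.update u.2 i y)) fun zs => zs i

lemma isPMF_auxEnc {p : 𝒳 × 𝒴 → ℝ} (hp : IsPMF p) {n : ℕ} {R : ℝ}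
    {enc : (Fin n → 𝒳) → Fin (msgCard n R) → ℝ} (henc : ∀ xs, IsPMF (enc xs))
    (i : Fin n) (y₀ : 𝒴) (x : 𝒳) : IsPMF fun u => auxEnc p enc i y₀ u x := by
  refine ⟨fun u => Finset.sum_nonneg fun xs _ => ?_, ?_⟩
  · split_ifs
    · exact mul_nonneg (Finset.prod_nonneg fun i _ => hp.1 _) ((henc _).1 _)
    · exact le_rfl
  · have h := sum_prod_erase hp.2 i (fun b => if b = (x, y₀) then 1 else 0)
    rw [Finset.sum_ite_eq' Finset.univ (x, y₀), if_pos (Finset.mem_univ _)] at h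
    have h' : ∑ w : (Fin n → 𝒳) × (Fin n → 𝒴), (if (w.1 i, w.2 i) = (x, y₀) then 1 else 0) *
        ∏ j ∈ Finset.univ.erase i, p (w.1 j, w.2 j) = 1 := by
      refine Eq.trans ?_ h
      exact Fintype.sum_equiv
        (Equiv.arrowProdEquivProdArrow (Fin n) (fun _ => 𝒳) fun _ => 𝒴).symm _ _ fun w => rfl
    rw [Fintype.sum_prod_type] at h'
    refine Eq.trans ?_ h'
    simp only [auxEnc]
    rw [Finset.sum_comm]
    refine Finset.sum_congr rfl fun xs _ => ?_
    rw [Fintype.sum_prod_type_right]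
    refine Finset.sum_congr rfl fun v _ => ?_
    simp only [Prod.mk.injEq]
    split_ifs
    · rw [← Finset.mul_sum, (henc _).2]; ring
    · simp

/-- The joint law of the auxiliary message and of the `i`-th letters. -/
lemma marg_inducedPMF (p : 𝒳 × 𝒴 → ℝ) {n : ℕ} {R : ℝ}
    (enc : (Fin n → 𝒳) → Fin (msgCard n R) → ℝ)
    (dec : Fin (msgCard n R) → (Fin n → 𝒴) → (Fin n → 𝒵) → ℝ) (i : Fin n) (y₀ : 𝒴)
    (u : Fin (msgCard n R) × (Fin n → 𝒴)) (w : 𝒳 × 𝒴 × 𝒵) :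
    marg (inducedPMF p n R enc dec)
      (fun ω => ((ω.2.2.1, Function.update ω.2.1 i y₀), ω.1 i, ω.2.1 i, ω.2.2.2 i)) (u, w) =
      strat p (auxEnc p enc i y₀ u) (auxDec dec i u) w := by
  obtain ⟨m, v⟩ := u
  obtain ⟨x, y, z⟩ := w
  simp only [marg, strat, auxEnc, auxDec, Fintype.sum_prod_type, Prod.mk.injEq]
  rw [mul_assoc, Finset.sum_mul, Finset.mul_sum]
  refine Finset.sum_congr rfl fun xs _ => ?_
  by_cases hx : xs i = x ∧ v i = y₀
  · obtain ⟨rfl, rfl⟩ := hx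
    have hupd : Function.update (Function.update v i y) i (v i) = v := by simp
    rw [Finset.sum_eq_single (Function.update v i y), Finset.sum_eq_single m]
    · simp only [hupd, Function.update_self, true_and, and_self, if_true, inducedPMF]
      rw [Finset.mul_sum, Finset.mul_sum]
      refine Finset.sum_congr rfl fun zs _ => ?_
      split_ifs
      · rw [← Finset.mul_prod_erase _ _ (Finset.mem_univ i), Function.update_self,
          Finset.prod_congr rfl fun j hj => by
            rw [Function.update_of_ne (Finset.ne_of_mem_erase hj)]]
        ring
      · simp
    · intro m' _ hm; simp [hm]
    · simp
    · intro ys _ hys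
      refine Finset.sum_eq_zero fun m' _ => Finset.sum_eq_zero fun zs _ => if_neg ?_
      rintro ⟨⟨-, h⟩, -, rfl, -⟩
      exact hys (by rw [← h]; simp)
    · simp
  · rw [if_neg hx, zero_mul, mul_zero]
    refine Finset.sum_eq_zero fun ys _ => Finset.sum_eq_zero fun m' _ =>
      Finset.sum_eq_zero fun zs _ => if_neg ?_
    rintro ⟨⟨-, h⟩, h', -⟩
    exact hx ⟨h', by rw [← h]; simp⟩

end SingleLetter

section Converse

open Real

variable {𝒳 𝒴 𝒵 : Type*} [Fintype 𝒳] [Fintype 𝒴] [Fintype 𝒵]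

lemma update_eq_update_and_iff {ι α : Type*} [DecidableEq ι] {a b : ι → α} {i : ι} {y : α} :
    Function.update a i y = Function.update b i y ∧ a i = b i ↔ a = b := by
  refine ⟨fun ⟨h, hi⟩ => funext fun j => ?_, by rintro rfl; exact ⟨rfl, rfl⟩⟩
  rcases eq_or_ne j i with rfl | hj
  · exact hi
  · simpa [hj] using congrFun h j

lemma sum_condFst_strat_eq (p : 𝒳 × 𝒴 → ℝ) {n : ℕ} {R : ℝ}
    (enc : (Fin n → 𝒳) → Fin (msgCard n R) → ℝ)
    (dec : Fin (msgCard n R) → (Fin n → 𝒴) → (Fin n → 𝒵) → ℝ) (i : Fin n) (y₀ : 𝒴) :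
    ∑ u, condFst (strat p (auxEnc p enc i y₀ u) (auxDec dec i u)) =
      centNat (inducedPMF p n R enc dec) (fun ω => ω.1 i)
        (fun ω => ((ω.2.2.1, ω.2.1), ω.2.2.2 i)) := by
  have h : ∀ u, strat p (auxEnc p enc i y₀ u) (auxDec dec i u) = fun w =>
      marg (inducedPMF p n R enc dec) (fun ω =>
        ((ω.2.2.1, Function.update ω.2.1 i y₀), ω.1 i, ω.2.1 i, ω.2.2.2 i)) (u, w) :=
    fun u => funext fun w => (marg_inducedPMF p enc dec i y₀ u w).symm
  simp only [h, sum_condFst_eq, ent_marg, centNat]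
  congr 1
  all_goals
    refine ent_congr _ fun a b => ?_
    simp only [Prod.mk.injEq]
    rw [← update_eq_update_and_iff (a := a.2.1) (i := i) (y := y₀)]
    tauto

/-- The block `(Xⁿ, Yⁿ, Ẑⁿ)` seen as a sequence of triples. -/
def zipXYZ {n : ℕ} {M : Type*} (ω : (Fin n → 𝒳) × (Fin n → 𝒴) × M × (Fin n → 𝒵)) (i : Fin n) :
    𝒳 × 𝒴 × 𝒵 :=
  (ω.1 i, ω.2.1 i, ω.2.2.2 i)

lemma sum_abs_marg_zipXYZ_sub {M : Type*} [Fintype M] (p : 𝒳 × 𝒴 → ℝ) (Q : 𝒳 → 𝒴 → 𝒵 → ℝ) {n : ℕ}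
    (P : (Fin n → 𝒳) × (Fin n → 𝒴) × M × (Fin n → 𝒵) → ℝ) :
    ∑ w, |marg P zipXYZ w - ∏ j, jointXYZ p Q (w j)| =
      2 * tv (fun w : (Fin n → 𝒳) × (Fin n → 𝒴) × (Fin n → 𝒵) => ∑ m, P (w.1, w.2.1, m, w.2.2))
        (prodXYZ p Q n) := by
  rw [tv, ← mul_assoc, show (2 : ℝ) * (1 / 2) = 1 by norm_num, one_mul]
  refine (Fintype.sum_equiv ((Equiv.arrowProdEquivProdArrow (Fin n) (fun _ => 𝒳) fun _ => 𝒴 × 𝒵).trans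
    ((Equiv.refl _).prodCongr
      (Equiv.arrowProdEquivProdArrow (Fin n) (fun _ => 𝒴) fun _ => 𝒵))).symm _ _ fun w => ?_).symm
  obtain ⟨xs, ys, zs⟩ := w
  congr 2
  have h : ∀ xs' ys' (m : M) zs', (zipXYZ (xs', ys', m, zs') = fun i => (xs i, ys i, zs i)) ↔
      xs' = xs ∧ ys' = ys ∧ zs' = zs := fun xs' ys' m zs' => by
    simp only [zipXYZ, funext_iff, Prod.mk.injEq, forall_and]
  change _ = marg P zipXYZ fun i => (xs i, ys i, zs i)
  simp only [marg, Fintype.sum_prod_type, h, ite_and]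
  simp [Finset.sum_ite_irrel]

/-- A securely achievable rate yields one-shot messages of arbitrarily good quality. -/
lemma exists_strat_near_of_securelyAchievable [Nonempty 𝒳] [Nonempty 𝒴] [Nonempty 𝒵]
    {p : 𝒳 × 𝒴 → ℝ} {Q : 𝒳 → 𝒴 → 𝒵 → ℝ} (hp : IsPMF p) (hQ : ∀ x y, IsPMF (Q x y)) {R : ℝ}
    (h : SecurelyAchievable p Q R) {δ : ℝ} (hδ : 0 < δ) :
    ∃ (n : ℕ) (e : Fin (msgCard n R) × (Fin n → 𝒴) → 𝒳 → ℝ)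
      (d : Fin (msgCard n R) × (Fin n → 𝒴) → 𝒴 → 𝒵 → ℝ),
      (∀ x, IsPMF fun u => e u x) ∧ (∀ u y, IsPMF (d u y)) ∧
      (∀ w, |∑ u, strat p (e u) (d u) w - jointXYZ p Q w| ≤ δ) ∧
      |∑ u, condFst (strat p (e u) (d u)) - condFst (jointXYZ p Q)| ≤ δ := by
  obtain ⟨-, enc, dec, henc, hdec, h⟩ := h
  set r := jointXYZ p Q
  have hr : IsPMF r := isPMF_jointXYZ hp hQ
  obtain ⟨θ₀, hθ₀, hθ⟩ := exists_entModulus_le (log (Fintype.card (𝒳 × 𝒴 × 𝒵)))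
    (δ := δ / 4) (by positivity)
  set θ := min θ₀ (min 1 δ)
  have hθpos : 0 < θ := by positivity
  have hθ1 : θ ≤ 1 := (min_le_right _ _).trans (min_le_left _ _)
  have hθδ : θ ≤ δ := (min_le_right _ _).trans (min_le_right _ _)
  replace hθ : ∀ t, 0 ≤ t → t ≤ θ → entModulus (log (Fintype.card (𝒳 × 𝒴 × 𝒵))) t ≤ δ / 4 :=
    fun t h0 h1 => hθ t h0 (h1.trans (min_le_left _ _))
  have hlog : 0 < log 2 := log_pos one_lt_two
  obtain ⟨n, hn, htv, hcmi⟩ := h (min (θ / 2) (δ / (2 * log 2))) (by positivity)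
  set P := inducedPMF p n R (enc n) (dec n)
  have hP : IsPMF P := isPMF_inducedPMF hp (henc n) (hdec n)
  set ρ := marg P zipXYZ
  have hρ : IsPMF ρ := hP.marg _
  have hclose : ∑ w, |ρ w - ∏ j, r (w j)| ≤ θ := by
    rw [sum_abs_marg_zipXYZ_sub]
    linarith [min_le_left (θ / 2) (δ / (2 * log 2))]
  have hcmiNat : cmiNat P (fun w => w.2.2.1) (fun w => (w.2.1, w.2.2.2)) (fun w => w.1) ≤
      n * (δ / 2) := by
    rw [cmi_eq, div_le_iff₀ hlog] at hcmi
    refine hcmi.trans ?_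
    rw [mul_assoc]
    refine mul_le_mul_of_nonneg_left ?_ (Nat.cast_nonneg n)
    refine (mul_le_mul_of_nonneg_right (min_le_right _ _) hlog.le).trans (le_of_eq ?_)
    field_simp
  have hcard : Fintype.card (𝒴 × 𝒵) ≤ Fintype.card (𝒳 × 𝒴 × 𝒵) :=
    Fintype.card_le_of_surjective Prod.snd Prod.snd_surjective
  set c : Fin n → ℝ := fun i =>
    centNat P (fun ω => ω.1 i) (fun ω => ((ω.2.2.1, ω.2.1), ω.2.2.2 i)) with hc
  have hupper : ∀ i, c i ≤ condFst r + δ := by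
    intro i
    have h1 := centNat_le hP (fun ω => ω.1 i) (fun ω => (ω.2.1 i, ω.2.2.2 i))
      (fun ω => (ω.2.2.1, ω.2.1))
    have h2 : c i = centNat P (fun ω => ω.1 i)
        (fun ω => ((ω.2.1 i, ω.2.2.2 i), (ω.2.2.1, ω.2.1))) := by
      simp only [hc, centNat]
      congr 1
      all_goals
        refine ent_congr _ fun a b => ?_
        simp only [Prod.mk.injEq]
        have : a.2.1 = b.2.1 → a.2.1 i = b.2.1 i := fun h => by rw [h]
        tauto
    have h3 : centNat P (fun ω => ω.1 i) (fun ω => (ω.2.1 i, ω.2.2.2 i)) =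
        ent ρ (fun w => w i) - ent ρ (fun w => (w i).2) := by
      simp only [ρ, ent_marg]; rfl
    have h4 := abs_le.mp (abs_ent_apply_sub_le hr hρ hθ hclose (fun a => a) le_rfl i)
    have h5 := abs_le.mp (abs_ent_apply_sub_le hr hρ hθ hclose Prod.snd hcard i)
    have h6 := condFst_eq r
    linarith [h4.2, h5.1]
  have hlower : n * (condFst r - δ) ≤ ∑ i, c i := by
    have h1 := centNat_pi_le hP (fun ω => ω.1) (fun ω => (ω.2.2.1, (ω.2.1, ω.2.2.2)))
    have h2 : ∀ i, centNat P (fun ω => ω.1 i) (fun ω => (ω.2.2.1, (ω.2.1, ω.2.2.2))) ≤ c i := by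
      intro i
      refine le_of_eq_of_le ?_ (centNat_le hP (fun ω => ω.1 i)
        (fun ω => ((ω.2.2.1, ω.2.1), ω.2.2.2 i)) (fun ω => ω.2.2.2))
      simp only [centNat]
      congr 1
      all_goals
        refine ent_congr _ fun a b => ?_
        simp only [Prod.mk.injEq]
        have : a.2.2.2 = b.2.2.2 → a.2.2.2 i = b.2.2.2 i := fun h => by rw [h]
        tauto
    have h3 : ent ρ (fun w => w) - ent ρ (fun w j => (w j).2) -
        cmiNat P (fun w => w.2.2.1) (fun w => (w.2.1, w.2.2.2)) (fun w => w.1) =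
        centNat P (fun ω => ω.1) (fun ω => (ω.2.2.1, (ω.2.1, ω.2.2.2))) := by
      have e1 : ent ρ (fun w => w) = ent P (fun w => ((w.2.1, w.2.2.2), w.1)) := by
        rw [ent_marg]
        refine ent_congr _ fun a b => ?_
        simp only [zipXYZ, Prod.mk.injEq, funext_iff, forall_and]
        tauto
      have e2 : ent ρ (fun w j => (w j).2) = ent P (fun w => (w.2.1, w.2.2.2)) := by
        rw [ent_marg]
        refine ent_congr _ fun a b => ?_
        simp only [zipXYZ, Prod.mk.injEq, funext_iff, forall_and]
      have e3 : ent P (fun w => (w.1, (w.2.2.1, (w.2.1, w.2.2.2)))) =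
          ent P (fun w => (w.2.2.1, (w.2.1, w.2.2.2), w.1)) :=
        ent_congr _ fun a b => by simp only [Prod.mk.injEq]; tauto
      rw [e1, e2, cmiNat, centNat, e3]
      ring
    have h4 := abs_le.mp (abs_ent_pi_sub_le hn hr hρ hθ1 hθ hclose (fun a => a) le_rfl)
    have h5 := abs_le.mp (abs_ent_pi_sub_le hn hr hρ hθ1 hθ hclose Prod.snd hcard)
    have h6 := condFst_eq r
    have h7 := Finset.sum_le_sum fun i (_ : i ∈ Finset.univ) => h2 i
    rw [h6]
    linarith [h4.1, h5.2]
  have : Nonempty (Fin n) := ⟨⟨0, hn⟩⟩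
  obtain ⟨i, -, hi⟩ := Finset.exists_le_of_sum_le (s := Finset.univ) Finset.univ_nonempty
    (f := fun _ : Fin n => condFst r - δ) (g := c) (by simpa [mul_sub] using hlower)
  let y₀ : 𝒴 := Classical.arbitrary 𝒴
  refine ⟨n, auxEnc p (enc n) i y₀, auxDec (dec n) i, isPMF_auxEnc hp (henc n) i y₀,
    fun u y => (hdec n _ _).marg _, fun w => ?_, ?_⟩
  · simp only [← marg_inducedPMF]
    rw [marg_fst_eq]
    refine le_trans ?_ ((abs_marg_apply_sub_le hr hclose i w).trans hθδ)
    simp only [ρ, marg_marg]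
    exact le_rfl
  · rw [sum_condFst_strat_eq, abs_le]
    constructor <;> linarith [hupper i]

end Converse

variable {𝒳 𝒴 𝒵 : Type*} [Fintype 𝒳] [Fintype 𝒴] [Fintype 𝒵]
variable [Nonempty 𝒳] [Nonempty 𝒴] [Nonempty 𝒵]

/-- `(p_XY, p_{Z|XY})` is computable with asymptotic security (i.e.
`R_S < ∞`, equivalently some rate is securely achievable) if and only if it is
computable with perfect security. -/
theorem asymptotic_iff_perfect
    (pXY : 𝒳 × 𝒴 → ℝ) (Q : 𝒳 → 𝒴 → 𝒵 → ℝ)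
    (hpXY : IsPMF pXY) (hQ : ∀ x y, IsPMF (Q x y)) :
    (∃ R, SecurelyAchievable pXY Q R) ↔ PerfectlySecure pXY Q := by
  constructor
  · rintro ⟨R, h⟩
    obtain ⟨k, e, d, he, hd, hJ, hh⟩ := exists_strat_of_approx pXY (jointXYZ pXY Q)
      (condFst (jointXYZ pXY Q)) fun δ hδ => by
        obtain ⟨n, e, d, h⟩ := exists_strat_near_of_securelyAchievable hpXY hQ h hδ
        exact ⟨_, inferInstance, e, d, h⟩
    exact perfectlySecure_of_strat hpXY hQ he hd hJ hh
  · rintro ⟨k, pU, h⟩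
    have hk : 0 < k := by
      rcases Nat.eq_zero_or_pos k with rfl | hk
      · simpa using (h.1 (Classical.arbitrary _)).2
      · exact hk
    obtain ⟨R, hR, rfl⟩ := exists_msgCard_one_eq hk
    exact ⟨R, securelyAchievable_of_secureAux hpXY hQ hR h⟩

end SC
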